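/- Let (r_T)_{T∈ℕ} be a sequence with r_T ≥ d/T for all T and lim_{T→∞} r_T = 0. Then for every x ∈ X and every θ ∈ Θ, ℙ_θ-almost surely lim_{T→∞} ĉ_{r_T}(x, θ̂_T) = c(x,θ). -/

import Mathlib

open scoped Classical

noncomputable section

def Theta (d : ℕ) : Set (Matrix (Fin d) (Fin d) ℝ) :=
  {θ | (∀ i j, 0 < θ i j) ∧ (∑ i, ∑ j, θ i j) = 1 ∧ ∀ i, (∑ j, θ i j) = ∑ j, θ j i}

def ThetaP (d : ℕ) : Set (Matrix (Fin d) (Fin d) ℝ) :=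
  {θ | (∀ i j, 0 ≤ θ i j) ∧ (∑ i, ∑ j, θ i j) = 1}

/-- Conditional relative entropy, with the conventions `0·log(0/q) = 0` and `p·log(p/0) = ∞`. -/
def condRelEnt {d : ℕ} (θ' θ : Matrix (Fin d) (Fin d) ℝ) : EReal :=
  ∑ i, ∑ j,
    if θ' i j = 0 then (0 : EReal)
    else if θ i j = 0 then (⊤ : EReal)
    else ((θ' i j * (Real.log (θ' i j / ∑ k, θ' i k) - Real.log (θ i j / ∑ k, θ i k)) : ℝ) : EReal)

/-- Real-valued conditional relative entropy (valid whenever `θ` has positive entries,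
so that no `∞` can occur; the convention `0·log(0/q) = 0` is automatic). -/
def condRelEntR {d : ℕ} (θ' θ : Matrix (Fin d) (Fin d) ℝ) : ℝ :=
  ∑ i, ∑ j, θ' i j * (Real.log (θ' i j / ∑ k, θ' i k) - Real.log (θ i j / ∑ k, θ i k))

/-- Empirical doublet distribution of the trajectory `ξ_0, …, ξ_T`. -/
def empDoublet {d : ℕ} (T : ℕ) (ξ : ℕ → Fin d) : Matrix (Fin d) (Fin d) ℝ :=
  Matrix.of fun i j =>
    (1 / (T : ℝ)) * ∑ t ∈ Finset.range T, if ξ t = i ∧ ξ (t + 1) = j then (1 : ℝ) else 0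

/-- Transition matrix associated with a doublet distribution. -/
def transOf {d : ℕ} (θ : Matrix (Fin d) (Fin d) ℝ) : Matrix (Fin d) (Fin d) ℝ :=
  Matrix.of fun i j => θ i j / ∑ k, θ i k

/-- Expected loss `c(x,θ)` for a fixed loss vector `ℓ = L(x,·)`. -/
def cfun {d : ℕ} (ℓ : Fin d → ℝ) (θ : Matrix (Fin d) (Fin d) ℝ) : ℝ :=
  ∑ i, ∑ j, ℓ i * θ i j

/-- The distributionally robust predictor `ĉ_r(x,θ')` (for the loss vector `ℓ = L(x,·)`):
the maximum of `c(x,·)` over the conditional-relative-entropy ball when it is nonempty,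
and the maximum over all of `cl Θ` otherwise. -/
def chat {d : ℕ} (ℓ : Fin d → ℝ) (r : ℝ) (θ' : Matrix (Fin d) (Fin d) ℝ) : ℝ :=
  if {θ | θ ∈ closure (Theta d) ∧ condRelEnt θ' θ ≤ (r : EReal)}.Nonempty then
    sSup (cfun ℓ '' {θ | θ ∈ closure (Theta d) ∧ condRelEnt θ' θ ≤ (r : EReal)})
  else sSup (cfun ℓ '' closure (Theta d))

open Filter Topology MeasureTheory

section DoubletDistributions

variable {d : ℕ}

lemma rowSum_pos_of_pos {A : Matrix (Fin d) (Fin d) ℝ} (hA : ∀ i j, 0 < A i j) (i : Fin d) :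
    0 < ∑ k, A i k :=
  Finset.sum_pos (fun j _ => hA i j) ⟨i, Finset.mem_univ i⟩

lemma rowSum_le_one {A : Matrix (Fin d) (Fin d) ℝ} (hA : ∀ i j, 0 ≤ A i j)
    (h1 : ∑ i, ∑ j, A i j = 1) (i : Fin d) : ∑ k, A i k ≤ 1 := by
  rw [← h1]
  exact Finset.single_le_sum (f := fun i => ∑ k, A i k)
    (fun i _ => Finset.sum_nonneg fun j _ => hA i j) (Finset.mem_univ i)

lemma entry_le_one {A : Matrix (Fin d) (Fin d) ℝ} (hA : ∀ i j, 0 ≤ A i j)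
    (h1 : ∑ i, ∑ j, A i j = 1) (i j : Fin d) : A i j ≤ 1 :=
  (Finset.single_le_sum (f := fun k => A i k) (fun k _ => hA i k) (Finset.mem_univ j)).trans
    (rowSum_le_one hA h1 i)

lemma closure_Theta_subset : closure (Theta d) ⊆
    {θ | (∀ i j, 0 ≤ θ i j) ∧ (∑ i, ∑ j, θ i j) = 1 ∧ ∀ i, (∑ j, θ i j) = ∑ j, θ j i} := by
  refine closure_minimal (fun θ h => ⟨fun i j => (h.1 i j).le, h.2⟩) ?_
  have hc : ∀ i j, Continuous fun θ : Matrix (Fin d) (Fin d) ℝ => θ i j :=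
    fun i j => continuous_id.matrix_elem i j
  refine IsClosed.and ?_ (IsClosed.and ?_ ?_)
  · simp only [Set.ofPred_forall]
    exact isClosed_iInter fun i => isClosed_iInter fun j => isClosed_le continuous_const (hc i j)
  · exact isClosed_eq (by fun_prop) continuous_const
  · simp only [Set.ofPred_forall]
    exact isClosed_iInter fun i => isClosed_eq (by fun_prop) (by fun_prop)

/-- A positive transition matrix has at most one stationary doublet distribution. -/
lemma eq_of_stationary {θ A : Matrix (Fin d) (Fin d) ℝ} (hθ : θ ∈ Theta d)
    (h1 : ∑ i, ∑ j, A i j = 1) (hb : ∀ i, ∑ j, A i j = ∑ j, A j i)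
    (hP : ∀ i j, A i j = (∑ k, A i k) * transOf θ i j) : A = θ := by
  obtain ⟨hpos, hsum, hbal⟩ := hθ
  have hπ := rowSum_pos_of_pos hpos
  have hθP : ∀ i j, θ i j = (∑ k, θ i k) * transOf θ i j := fun i j => by
    simp only [transOf, Matrix.of_apply]
    field_simp [(hπ i).ne']
  have hPpos : ∀ i j, 0 < transOf θ i j := fun i j => div_pos (hpos i j) (hπ i)
  have hne : Nonempty (Fin d) := by
    by_contra h
    rw [not_nonempty_iff] at h
    simp at h1
  obtain ⟨a, ha⟩ := Finite.exists_min fun i => (∑ k, A i k) / ∑ k, θ i k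
  set m := (∑ k, A a k) / ∑ k, θ a k with hm
  have hnn : ∀ i, 0 ≤ ∑ k, A i k - m * ∑ k, θ i k := fun i => by
    have := (le_div_iff₀ (hπ i)).1 (ha i)
    linarith
  have hzero : ∑ i, (∑ k, A i k - m * ∑ k, θ i k) * transOf θ i a = 0 := by
    have e : ∀ i, (∑ k, A i k - m * ∑ k, θ i k) * transOf θ i a = A i a - m * θ i a := fun i => by
      rw [sub_mul, ← hP i a, mul_assoc, ← hθP i a]
    simp_rw [e]
    rw [Finset.sum_sub_distrib, ← Finset.mul_sum, ← hb, ← hbal, hm]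
    field_simp [(hπ a).ne']
    ring
  have hall : ∀ i, ∑ k, A i k = m * ∑ k, θ i k := fun i => by
    have := (Finset.sum_eq_zero_iff_of_nonneg
      (fun i _ => mul_nonneg (hnn i) (hPpos i a).le)).1 hzero i (Finset.mem_univ i)
    rcases mul_eq_zero.1 this with h | h
    · linarith
    · exact absurd h (hPpos i a).ne'
  have hm1 : m = 1 := by
    have : ∑ i, ∑ k, A i k = m * ∑ i, ∑ k, θ i k := by
      rw [Finset.mul_sum]
      exact Finset.sum_congr rfl fun i _ => hall i
    rw [h1, hsum, mul_one] at this
    exact this.symm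
  ext i j
  rw [hP, hall, hm1, one_mul, ← hθP]

/-- Approximately stationary doublet distributions of a positive transition matrix converge to the
stationary one. -/
lemma tendsto_of_approx_stationary {θ : Matrix (Fin d) (Fin d) ℝ} (hθ : θ ∈ Theta d)
    {A : ℕ → Matrix (Fin d) (Fin d) ℝ} (h0 : ∀ᶠ T in atTop, ∀ i j, 0 ≤ A T i j)
    (h1 : ∀ᶠ T in atTop, ∑ i, ∑ j, A T i j = 1)
    (hb : ∀ i, Tendsto (fun T => ∑ j, A T i j - ∑ j, A T j i) atTop (𝓝 0))
    (hP : ∀ i j, Tendsto (fun T => A T i j - (∑ k, A T i k) * transOf θ i j) atTop (𝓝 0)) :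
    Tendsto A atTop (𝓝 θ) := by
  have hK : IsCompact {B : Matrix (Fin d) (Fin d) ℝ | ∀ i, B i ∈ {v | ∀ j, v j ∈ Set.Icc (0 : ℝ) 1}} :=
    isCompact_pi_infinite fun _ => isCompact_pi_infinite fun _ => isCompact_Icc
  refine hK.tendsto_nhds_of_unique_mapClusterPt ?_ fun B _ hcl => ?_
  · filter_upwards [h0, h1] with T hT hT' i j
    exact ⟨hT i j, entry_le_one hT hT' i j⟩
  · have key : ∀ (f : Matrix (Fin d) (Fin d) ℝ → ℝ) (c : ℝ), Continuous f →
        Tendsto (fun T => f (A T)) atTop (𝓝 c) → f B = c := fun f c hf ht => by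
      have h := hcl.continuousAt_comp hf.continuousAt
      exact eq_of_nhds_neBot (Filter.NeBot.mono h (inf_le_inf_left _ ht))
    refine eq_of_stationary hθ ?_ (fun i => ?_) fun i j => ?_
    · exact key (fun B => ∑ i, ∑ j, B i j) 1 (by fun_prop)
        (tendsto_const_nhds.congr' (h1.mono fun _ h => h.symm))
    · exact sub_eq_zero.1 (key (fun B => ∑ j, B i j - ∑ j, B j i) 0 (by fun_prop) (hb i))
    · exact sub_eq_zero.1 (key (fun B => B i j - (∑ k, B i k) * transOf θ i j) 0
        (by fun_prop) (hP i j))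

end DoubletDistributions

section RelativeEntropy

variable {d : ℕ}

lemma ereal_coe_sum {ι : Type*} (s : Finset ι) (f : ι → ℝ) :
    ((∑ i ∈ s, f i : ℝ) : EReal) = ∑ i ∈ s, (f i : EReal) :=
  map_sum (⟨⟨Real.toEReal, EReal.coe_zero⟩, EReal.coe_add⟩ : ℝ →+ EReal) f s

lemma sq_sqrt_sub_le_mul_log {p q : ℝ} (hp : 0 < p) (hq : 0 < q) :
    p - q + (√p - √q) ^ 2 ≤ p * (Real.log p - Real.log q) := by
  have hsp := Real.sqrt_pos.2 hp
  have hsq := Real.sqrt_pos.2 hq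
  have h1 := Real.sq_sqrt hp.le
  have h2 := Real.sq_sqrt hq.le
  have h := Real.log_le_sub_one_of_pos (div_pos hsq hsp)
  rw [Real.log_div hsq.ne' hsp.ne', Real.log_sqrt hp.le, Real.log_sqrt hq.le] at h
  have h3 := mul_le_mul_of_nonneg_left h hp.le
  have h4 : p * (√q / √p) = √p * √q := by
    field_simp
    rw [h1]
  nlinarith

lemma rowSum_transOf_le_one (A : Matrix (Fin d) (Fin d) ℝ) (i : Fin d) :
    ∑ j, transOf A i j ≤ 1 := by
  simp only [transOf, Matrix.of_apply]
  rw [← Finset.sum_div]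
  exact div_self_le_one _

/-- The conditional relative entropy dominates the squared Hellinger distance of the rows. -/
lemma sq_sqrt_transOf_sub_le {A B : Matrix (Fin d) (Fin d) ℝ} (hA : ∀ i j, 0 < A i j)
    (hB : ∀ i j, 0 ≤ B i j) {r : ℝ} (h : condRelEnt A B ≤ (r : EReal)) (i j : Fin d) :
    (∑ k, A i k) * (√(transOf A i j) - √(transOf B i j)) ^ 2 ≤ r := by
  have hw := rowSum_pos_of_pos hA
  set g : Fin d → Fin d → ℝ := fun i j => (∑ k, A i k) *
    (transOf A i j - transOf B i j + (√(transOf A i j) - √(transOf B i j)) ^ 2) with hg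
  have hle : ((∑ i, ∑ j, g i j : ℝ) : EReal) ≤ condRelEnt A B := by
    simp only [ereal_coe_sum, condRelEnt]
    refine Finset.sum_le_sum fun i _ => Finset.sum_le_sum fun j _ => ?_
    rw [if_neg (hA i j).ne']
    split_ifs with h0
    · exact le_top
    · rw [EReal.coe_le_coe_iff]
      have hBpos : 0 < B i j := lt_of_le_of_ne (hB i j) (Ne.symm h0)
      have hBw : 0 < ∑ k, B i k :=
        hBpos.trans_le (Finset.single_le_sum (fun k _ => hB i k) (Finset.mem_univ j))
      have := mul_le_mul_of_nonneg_left
        (sq_sqrt_sub_le_mul_log (div_pos (hA i j) (hw i)) (div_pos hBpos hBw)) (hw i).le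
      refine this.trans_eq ?_
      rw [← mul_assoc, mul_div_cancel₀ _ (hw i).ne']
  have hreal : ∑ i, ∑ j, g i j ≤ r := EReal.coe_le_coe_iff.1 (hle.trans h)
  have hrow : ∀ i, ∑ j, (∑ k, A i k) * (√(transOf A i j) - √(transOf B i j)) ^ 2 ≤ ∑ j, g i j := by
    intro i
    have hA1 : ∑ j, transOf A i j = 1 := by
      simp only [transOf, Matrix.of_apply]
      rw [← Finset.sum_div, div_self (hw i).ne']
    simp only [hg, ← Finset.mul_sum, Finset.sum_add_distrib, Finset.sum_sub_distrib, hA1]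
    refine mul_le_mul_of_nonneg_left ?_ (hw i).le
    linarith [rowSum_transOf_le_one B i]
  have hnn : ∀ i j, 0 ≤ (∑ k, A i k) * (√(transOf A i j) - √(transOf B i j)) ^ 2 :=
    fun i j => mul_nonneg (hw i).le (sq_nonneg _)
  calc _ ≤ ∑ j, (∑ k, A i k) * (√(transOf A i j) - √(transOf B i j)) ^ 2 :=
        Finset.single_le_sum (fun j _ => hnn i j) (Finset.mem_univ j)
    _ ≤ ∑ i, ∑ j, (∑ k, A i k) * (√(transOf A i j) - √(transOf B i j)) ^ 2 :=
        Finset.single_le_sum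
          (f := fun i => ∑ j, (∑ k, A i k) * (√(transOf A i j) - √(transOf B i j)) ^ 2)
          (fun i _ => Finset.sum_nonneg fun j _ => hnn i j) (Finset.mem_univ i)
    _ ≤ r := (Finset.sum_le_sum fun i _ => hrow i).trans hreal

/-- The doublet distribution obtained from `T` transitions by adding one transition `a → b`. -/
def addTransition (T : ℕ) (A : Matrix (Fin d) (Fin d) ℝ) (a b : Fin d) :
    Matrix (Fin d) (Fin d) ℝ :=
  Matrix.of fun i j => (T * A i j + if i = a ∧ j = b then 1 else 0) / (T + 1)

lemma rowSum_addTransition (T : ℕ) (A : Matrix (Fin d) (Fin d) ℝ) (a b i : Fin d) :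
    ∑ j, addTransition T A a b i j = (T * ∑ j, A i j + if i = a then 1 else 0) / (T + 1) := by
  simp only [addTransition, Matrix.of_apply, ← Finset.sum_div, Finset.sum_add_distrib,
    ← Finset.mul_sum]
  by_cases h : i = a <;> simp [h]

lemma colSum_addTransition (T : ℕ) (A : Matrix (Fin d) (Fin d) ℝ) (a b j : Fin d) :
    ∑ i, addTransition T A a b i j = (T * ∑ i, A i j + if j = b then 1 else 0) / (T + 1) := by
  simp only [addTransition, Matrix.of_apply, ← Finset.sum_div, Finset.sum_add_distrib,
    ← Finset.mul_sum]
  by_cases h : j = b <;> simp [h]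

lemma condRelEnt_addTransition_le {T : ℕ} (hT : 1 ≤ T) {A : Matrix (Fin d) (Fin d) ℝ}
    (hA : ∀ i j, 0 < A i j) (a b : Fin d) :
    condRelEnt A (addTransition T A a b) ≤ ((1 / T : ℝ) : EReal) := by
  have hw := rowSum_pos_of_pos hA
  have hT0 : (0 : ℝ) < T := by exact_mod_cast hT
  have hsum : ∑ i, ∑ j, A i j * ((if i = a then 1 else 0) / (T * ∑ k, A i k)) = (1 / T : ℝ) := by
    have : ∀ i, ∑ j, A i j * ((if i = a then 1 else 0) / (T * ∑ k, A i k)) =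
        if i = a then (1 / T : ℝ) else 0 := fun i => by
      have := (hw i).ne'
      rw [← Finset.sum_mul]
      split_ifs
      · field_simp
      · simp
    simp [this]
  rw [← hsum]
  simp only [ereal_coe_sum, condRelEnt]
  refine Finset.sum_le_sum fun i _ => Finset.sum_le_sum fun j _ => ?_
  have hδ : (0 : ℝ) ≤ if i = a ∧ j = b then 1 else 0 := by split_ifs <;> norm_num
  have hε : (0 : ℝ) ≤ if i = a then 1 else 0 := by split_ifs <;> norm_num
  have hTA : 0 < T * A i j := mul_pos hT0 (hA i j)
  have hTw : 0 < T * ∑ k, A i k := mul_pos hT0 (hw i)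
  have hB : 0 < addTransition T A a b i j :=
    div_pos (by linarith) (by linarith)
  rw [if_neg (hA i j).ne', if_neg hB.ne', EReal.coe_le_coe_iff, rowSum_addTransition]
  refine mul_le_mul_of_nonneg_left ?_ (hA i j).le
  simp only [addTransition, Matrix.of_apply]
  rw [div_div_div_cancel_right₀ (by linarith)]
  have hlow : T * A i j / (T * ∑ k, A i k + if i = a then 1 else 0) ≤
      (T * A i j + if i = a ∧ j = b then 1 else 0) / (T * ∑ k, A i k + if i = a then 1 else 0) := by
    gcongr
    linarith
  have hlog := Real.log_le_log (div_pos hTA (by linarith)) hlow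
  rw [Real.log_div hTA.ne' (by linarith), Real.log_mul hT0.ne' (hA i j).ne'] at hlog
  rw [Real.log_div (hA i j).ne' (hw i).ne']
  have h2 := Real.log_le_sub_one_of_pos
    (div_pos (add_pos_of_pos_of_nonneg hTw hε) hTw)
  rw [Real.log_div (by linarith) hTw.ne', Real.log_mul hT0.ne' (hw i).ne', add_div,
    div_self hTw.ne'] at h2
  linarith

end RelativeEntropy

section EmpiricalDoublets

variable {d : ℕ}

lemma empDoublet_nonneg (T : ℕ) (ω : ℕ → Fin d) (i j : Fin d) : 0 ≤ empDoublet T ω i j := by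
  simp only [empDoublet, Matrix.of_apply]
  exact mul_nonneg (by positivity) (Finset.sum_nonneg fun t _ => by split_ifs <;> norm_num)

lemma rowSum_empDoublet (T : ℕ) (ω : ℕ → Fin d) (i : Fin d) :
    ∑ j, empDoublet T ω i j = 1 / T * ∑ t ∈ Finset.range T, if ω t = i then (1 : ℝ) else 0 := by
  simp only [empDoublet, Matrix.of_apply]
  rw [← Finset.mul_sum, Finset.sum_comm]
  congr 1
  refine Finset.sum_congr rfl fun t _ => ?_
  by_cases h : ω t = i <;> simp [h]

lemma colSum_empDoublet (T : ℕ) (ω : ℕ → Fin d) (j : Fin d) :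
    ∑ i, empDoublet T ω i j =
      1 / T * ∑ t ∈ Finset.range T, if ω (t + 1) = j then (1 : ℝ) else 0 := by
  simp only [empDoublet, Matrix.of_apply]
  rw [← Finset.mul_sum, Finset.sum_comm]
  congr 1
  refine Finset.sum_congr rfl fun t _ => ?_
  by_cases h : ω (t + 1) = j <;> simp [h]

lemma sum_empDoublet {T : ℕ} (hT : 1 ≤ T) (ω : ℕ → Fin d) :
    ∑ i, ∑ j, empDoublet T ω i j = 1 := by
  have hT0 : (T : ℝ) ≠ 0 := by positivity
  simp only [rowSum_empDoublet]
  rw [← Finset.mul_sum, Finset.sum_comm]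
  simp [hT0]

lemma rowSum_sub_colSum_empDoublet (T : ℕ) (ω : ℕ → Fin d) (i : Fin d) :
    ∑ j, empDoublet T ω i j - ∑ j, empDoublet T ω j i =
      1 / T * ((if ω 0 = i then 1 else 0) - if ω T = i then 1 else 0) := by
  rw [rowSum_empDoublet, colSum_empDoublet, ← mul_sub, ← Finset.sum_sub_distrib]
  congr 1
  exact Finset.sum_range_sub' (fun t => if ω t = i then (1 : ℝ) else 0) T

lemma addTransition_empDoublet_mem_Theta {T : ℕ} (hT : 1 ≤ T) (ω : ℕ → Fin d)
    (hpos : ∀ i j, 0 < empDoublet T ω i j) :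
    addTransition T (empDoublet T ω) (ω T) (ω 0) ∈ Theta d := by
  have hT0 : (0 : ℝ) < T := by exact_mod_cast hT
  refine ⟨fun i j => ?_, ?_, fun i => ?_⟩
  · simp only [addTransition, Matrix.of_apply]
    have := hpos i j
    positivity
  · simp only [rowSum_addTransition]
    rw [← Finset.sum_div, Finset.sum_add_distrib, ← Finset.mul_sum, sum_empDoublet hT]
    simp only [Finset.sum_ite_eq', Finset.mem_univ, if_true, mul_one]
    exact div_self (by positivity)
  · rw [rowSum_addTransition, colSum_addTransition]
    congr 1
    have h := rowSum_sub_colSum_empDoublet T ω i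
    have h' := congrArg (fun y => (T : ℝ) * y) h
    simp only [← mul_assoc, mul_one_div_cancel hT0.ne', one_mul, mul_sub] at h'
    simp only [eq_comm (a := i)]
    linarith

/-- The martingale of centred transition counts. -/
def centredCount (P : Matrix (Fin d) (Fin d) ℝ) (i j : Fin d) (T : ℕ) (ω : ℕ → Fin d) : ℝ :=
  ∑ t ∈ Finset.range T, if ω t = i then (if ω (t + 1) = j then 1 else 0) - P i j else 0

lemma empDoublet_sub_eq (P : Matrix (Fin d) (Fin d) ℝ) (i j : Fin d) (T : ℕ) (ω : ℕ → Fin d) :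
    empDoublet T ω i j - (∑ k, empDoublet T ω i k) * P i j =
      centredCount P i j T ω / T := by
  rw [rowSum_empDoublet]
  simp only [empDoublet, Matrix.of_apply, centredCount]
  rw [mul_assoc, ← mul_sub, Finset.sum_mul, ← Finset.sum_sub_distrib, one_div_mul_eq_div]
  congr 1
  refine Finset.sum_congr rfl fun t _ => ?_
  by_cases h : ω t = i <;> simp [h]

lemma abs_centredCount_sub_le {P : Matrix (Fin d) (Fin d) ℝ} {i j : Fin d} (h0 : 0 ≤ P i j)
    (h1 : P i j ≤ 1) (S n : ℕ) (ω : ℕ → Fin d) :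
    |centredCount P i j (S + n) ω - centredCount P i j S ω| ≤ n := by
  simp only [centredCount, Finset.sum_range_add, add_sub_cancel_left]
  refine (Finset.abs_sum_le_sum_abs _ _).trans ?_
  refine (Finset.sum_le_card_nsmul _ _ 1 fun t _ => ?_).trans (by simp)
  split_ifs <;> rw [abs_le] <;> constructor <;> linarith

end EmpiricalDoublets

section LawOfLargeNumbers

variable {d : ℕ}

lemma tendsto_zero_of_sq {f : ℕ → ℝ} (h : Tendsto (fun n => f n ^ 2) atTop (𝓝 0)) :
    Tendsto f atTop (𝓝 0) := by
  rw [tendsto_zero_iff_abs_tendsto_zero]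
  simpa [Real.sqrt_sq_eq_abs, Function.comp_def] using h.sqrt

lemma measurableSet_coord_eq (t : ℕ) (k : Fin d) : MeasurableSet {ω : ℕ → Fin d | ω t = k} :=
  measurableSet_eq_fun (measurable_pi_apply t) measurable_const

lemma measurable_centredCount (P : Matrix (Fin d) (Fin d) ℝ) (i j : Fin d) (T : ℕ) :
    Measurable (centredCount P i j T) := by
  unfold centredCount
  refine Finset.measurable_sum _ fun t _ => ?_
  exact Measurable.ite (measurableSet_coord_eq t i)
    ((Measurable.ite (measurableSet_coord_eq _ j) measurable_const measurable_const).sub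
    measurable_const) measurable_const

lemma measurableSet_cylinder_prefix (T : ℕ) (s : ℕ → Fin d) :
    MeasurableSet {ω : ℕ → Fin d | ∀ t ≤ T, ω t = s t} := by
  simp only [Set.ofPred_forall]
  exact MeasurableSet.iInter fun t => MeasurableSet.iInter fun _ =>
    measurableSet_coord_eq t (s t)

variable {P : Matrix (Fin d) (Fin d) ℝ} {ξ0 : Fin d} {μ : Measure (ℕ → Fin d)}

lemma measureReal_prefix_succ (hP : ∀ i j, 0 ≤ P i j)
    (hμ : ∀ T : ℕ, ∀ s : ℕ → Fin d, μ {ω | ∀ t ≤ T, ω t = s t} =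
      ENNReal.ofReal (if s 0 = ξ0 then ∏ t ∈ Finset.range T, P (s t) (s (t + 1)) else 0))
    (T : ℕ) (s : ℕ → Fin d) (b : Fin d) :
    μ.real ({ω | ∀ t ≤ T, ω t = s t} ∩ {ω | ω (T + 1) = b}) =
      μ.real {ω | ∀ t ≤ T, ω t = s t} * P (s T) b := by
  have hset : {ω : ℕ → Fin d | ∀ t ≤ T, ω t = s t} ∩ {ω | ω (T + 1) = b} =
      {ω | ∀ t ≤ T + 1, ω t = Function.update s (T + 1) b t} := by
    ext ω
    simp only [Set.mem_inter_iff, Set.mem_ofPred_eq]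
    constructor
    · rintro ⟨h, h'⟩ t ht
      rcases Nat.le_succ_iff.1 ht with h2 | rfl
      · rw [Function.update_of_ne (by omega), h t h2]
      · simpa using h'
    · intro h
      refine ⟨fun t ht => ?_, by simpa using h (T + 1) le_rfl⟩
      rw [h t (by omega), Function.update_of_ne (by omega)]
  have hnn : ∀ (T : ℕ) (s : ℕ → Fin d),
      0 ≤ if s 0 = ξ0 then ∏ t ∈ Finset.range T, P (s t) (s (t + 1)) else 0 := fun T s => by
    split_ifs
    · exact Finset.prod_nonneg fun t _ => hP _ _
    · exact le_rfl
  rw [hset, measureReal_def, measureReal_def, hμ, hμ, ENNReal.toReal_ofReal (hnn _ _),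
    ENNReal.toReal_ofReal (hnn _ _), Finset.prod_range_succ,
    Function.update_of_ne (by omega : 0 ≠ T + 1), Function.update_self,
    Function.update_of_ne (by omega : T ≠ T + 1)]
  have : ∏ t ∈ Finset.range T,
      P (Function.update s (T + 1) b t) (Function.update s (T + 1) b (t + 1)) =
      ∏ t ∈ Finset.range T, P (s t) (s (t + 1)) := by
    refine Finset.prod_congr rfl fun t ht => ?_
    have := Finset.mem_range.1 ht
    rw [Function.update_of_ne (by omega), Function.update_of_ne (by omega)]
  rw [this, ite_mul, zero_mul]

/-- The increment of the centred count is orthogonal to functions of the past. -/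
lemma integral_mul_increment_eq_zero [IsProbabilityMeasure μ] (hP : ∀ i j, 0 ≤ P i j)
    (hμ : ∀ T : ℕ, ∀ s : ℕ → Fin d, μ {ω | ∀ t ≤ T, ω t = s t} =
      ENNReal.ofReal (if s 0 = ξ0 then ∏ t ∈ Finset.range T, P (s t) (s (t + 1)) else 0))
    (i j : Fin d) (T : ℕ) (f : (ℕ → Fin d) → ℝ)
    (hf : ∀ ω ω', (∀ t ≤ T, ω t = ω' t) → f ω = f ω') :
    ∫ ω, f ω * (if ω T = i then (if ω (T + 1) = j then 1 else 0) - P i j else 0) ∂μ = 0 := by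
  set ext : (Fin (T + 1) → Fin d) → ℕ → Fin d :=
    fun u t => if h : t < T + 1 then u ⟨t, h⟩ else ξ0 with hext
  set C : (Fin (T + 1) → Fin d) → Set (ℕ → Fin d) := fun u => {ω | ∀ t ≤ T, ω t = ext u t} with hC
  have hCm : ∀ u, MeasurableSet (C u) := fun u => measurableSet_cylinder_prefix T (ext u)
  have hjm : MeasurableSet {ω : ℕ → Fin d | ω (T + 1) = j} :=
    measurableSet_coord_eq (T + 1) j
  have hmem : ∀ ω u, ω ∈ C u ↔ u = fun t : Fin (T + 1) => ω t := fun ω u => by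
    simp only [hC, hext, Set.mem_ofPred_eq, funext_iff]
    constructor
    · intro h t
      rw [h t (by omega), dif_pos t.2]
    · intro h t ht
      rw [dif_pos (by omega), h]
  have hpt : ∀ ω, f ω * (if ω T = i then (if ω (T + 1) = j then 1 else 0) - P i j else 0) =
      ∑ u, (f (ext u) * if ext u T = i then 1 else 0) *
        ((C u ∩ {ω | ω (T + 1) = j}).indicator 1 ω - P i j * (C u).indicator 1 ω) := fun ω => by
    have hω := (hmem ω _).2 rfl
    rw [Finset.sum_eq_single_of_mem (fun t : Fin (T + 1) => ω t) (Finset.mem_univ _)]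
    · have h1 : f (ext fun t : Fin (T + 1) => ω t) = f ω :=
        hf _ _ fun t ht => (hω t ht).symm
      rw [h1, ← hω T le_rfl, Set.indicator_of_mem hω]
      by_cases hi : ω T = i <;> by_cases hj : ω (T + 1) = j <;>
        simp [hi, hj, hω]
    · intro u _ hu
      have : ω ∉ C u := fun h => hu ((hmem ω u).1 h)
      simp [this]
  have hint : ∀ s : Set (ℕ → Fin d), MeasurableSet s →
      Integrable (s.indicator (1 : (ℕ → Fin d) → ℝ)) μ := fun s hs =>
    (integrable_const (1 : ℝ)).indicator hs
  simp only [hpt]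
  rw [integral_finsetSum]
  swap
  · exact fun u _ =>
      ((hint _ ((hCm u).inter hjm)).sub ((hint _ (hCm u)).const_mul _)).const_mul _
  refine Finset.sum_eq_zero fun u _ => ?_
  rw [integral_const_mul, integral_sub (hint _ ((hCm u).inter hjm)) ((hint _ (hCm u)).const_mul _),
    integral_const_mul, integral_indicator_one ((hCm u).inter hjm), integral_indicator_one (hCm u),
    measureReal_prefix_succ hP hμ]
  by_cases h : ext u T = i
  · rw [h]
    ring
  · simp [h]

lemma integrable_of_abs_le [IsProbabilityMeasure μ] {f : (ℕ → Fin d) → ℝ} (hf : Measurable f)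
    (c : ℝ) (h : ∀ ω, |f ω| ≤ c) : Integrable f μ :=
  Integrable.of_bound hf.aestronglyMeasurable c (Eventually.of_forall h)

lemma abs_centredCount_le {i j : Fin d} (h0 : 0 ≤ P i j) (h1 : P i j ≤ 1) (T : ℕ)
    (ω : ℕ → Fin d) : |centredCount P i j T ω| ≤ T := by
  simpa [centredCount] using abs_centredCount_sub_le h0 h1 0 T ω

lemma integral_centredCount_sq_le [IsProbabilityMeasure μ] (hP : ∀ i j, 0 ≤ P i j)
    (hP1 : ∀ i j, P i j ≤ 1)
    (hμ : ∀ T : ℕ, ∀ s : ℕ → Fin d, μ {ω | ∀ t ≤ T, ω t = s t} =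
      ENNReal.ofReal (if s 0 = ξ0 then ∏ t ∈ Finset.range T, P (s t) (s (t + 1)) else 0))
    (i j : Fin d) (T : ℕ) : ∫ ω, centredCount P i j T ω ^ 2 ∂μ ≤ T := by
  induction T with
  | zero => simp [centredCount]
  | succ T ih =>
    set Y : (ℕ → Fin d) → ℝ :=
      fun ω => if ω T = i then (if ω (T + 1) = j then 1 else 0) - P i j else 0 with hY
    have hsucc : ∀ ω, centredCount P i j (T + 1) ω = centredCount P i j T ω + Y ω := fun ω =>
      Finset.sum_range_succ _ _
    have hM := measurable_centredCount P i j T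
    have hMb := abs_centredCount_le (hP i j) (hP1 i j) T
    have hYm : Measurable Y := by
      have : Y = fun ω => centredCount P i j (T + 1) ω - centredCount P i j T ω := by
        ext ω
        rw [hsucc, add_sub_cancel_left]
      rw [this]
      exact (measurable_centredCount P i j (T + 1)).sub hM
    have hYb : ∀ ω, |Y ω| ≤ 1 := fun ω => by
      have := abs_centredCount_sub_le (hP i j) (hP1 i j) T 1 ω
      rwa [hsucc, add_sub_cancel_left, Nat.cast_one] at this
    have horth : ∫ ω, centredCount P i j T ω * Y ω ∂μ = 0 :=
      integral_mul_increment_eq_zero hP hμ i j T _ fun ω ω' h =>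
        Finset.sum_congr rfl fun t ht => by
          have := Finset.mem_range.1 ht
          rw [h t (by omega), h (t + 1) (by omega)]
    have i1 : Integrable (fun ω => centredCount P i j T ω ^ 2) μ :=
      integrable_of_abs_le (hM.pow_const 2) ((T : ℝ) ^ 2) fun ω => by
        rw [abs_pow]
        exact pow_le_pow_left₀ (abs_nonneg _) (hMb ω) 2
    have i2 : Integrable (fun ω => centredCount P i j T ω * Y ω) μ :=
      integrable_of_abs_le (hM.mul hYm) (T * 1) fun ω => by
        rw [abs_mul]
        exact mul_le_mul (hMb ω) (hYb ω) (abs_nonneg _) (by positivity)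
    have hYsq : ∀ ω, Y ω ^ 2 ≤ 1 := fun ω => (sq_le_one_iff_abs_le_one _).2 (hYb ω)
    have hbound : ∀ ω, centredCount P i j (T + 1) ω ^ 2 ≤
        centredCount P i j T ω ^ 2 + 2 * (centredCount P i j T ω * Y ω) + 1 := fun ω => by
      rw [hsucc]
      nlinarith [hYsq ω]
    have hmono := integral_mono_of_nonneg (Eventually.of_forall fun ω => sq_nonneg _)
      ((i1.add (i2.const_mul 2)).add (integrable_const (1 : ℝ))) (Eventually.of_forall hbound)
    refine hmono.trans ?_
    rw [integral_add' (i1.add (i2.const_mul 2)) (integrable_const (1 : ℝ)),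
      integral_add' i1 (i2.const_mul 2), integral_const_mul, horth]
    simp only [integral_const, probReal_univ, smul_eq_mul, mul_one, mul_zero, add_zero]
    push_cast
    linarith

lemma ae_tendsto_centredCount_sq_div [IsProbabilityMeasure μ] (hP : ∀ i j, 0 ≤ P i j)
    (hP1 : ∀ i j, P i j ≤ 1)
    (hμ : ∀ T : ℕ, ∀ s : ℕ → Fin d, μ {ω | ∀ t ≤ T, ω t = s t} =
      ENNReal.ofReal (if s 0 = ξ0 then ∏ t ∈ Finset.range T, P (s t) (s (t + 1)) else 0))
    (i j : Fin d) :
    ∀ᵐ ω ∂μ, Tendsto (fun k : ℕ => centredCount P i j (k ^ 2) ω / (k : ℝ) ^ 2) atTop (𝓝 0) := by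
  set F : ℕ → (ℕ → Fin d) → ℝ := fun k ω => (centredCount P i j (k ^ 2) ω / (k : ℝ) ^ 2) ^ 2
  have hFm : ∀ k, Measurable (F k) := fun k =>
    ((measurable_centredCount P i j (k ^ 2)).div_const _).pow_const 2
  have hFint : ∀ k, ∫⁻ ω, ENNReal.ofReal (F k ω) ∂μ ≤ ENNReal.ofReal (1 / (k : ℝ) ^ 2) := by
    intro k
    have hFi : Integrable (F k) μ := by
      refine integrable_of_abs_le (hFm k) 1 fun ω => ?_
      have h := abs_centredCount_le (hP i j) (hP1 i j) (k ^ 2) ω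
      rw [abs_pow, abs_div, abs_of_nonneg (by positivity : (0 : ℝ) ≤ (k : ℝ) ^ 2)]
      refine pow_le_one₀ (by positivity) (div_le_one_of_le₀ ?_ (by positivity))
      exact_mod_cast h
    rw [← ofReal_integral_eq_lintegral_ofReal hFi (Eventually.of_forall fun ω => sq_nonneg _)]
    refine ENNReal.ofReal_le_ofReal ?_
    simp only [F, div_pow]
    rw [integral_div]
    have h := integral_centredCount_sq_le hP hP1 hμ i j (k ^ 2)
    push_cast at h
    rcases Nat.eq_zero_or_pos k with rfl | hk
    · simp
    · have hk' : (0 : ℝ) < k := by exact_mod_cast hk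
      rw [div_le_div_iff₀ (by positivity) (by positivity), one_mul, sq ((k : ℝ) ^ 2)]
      exact mul_le_mul_of_nonneg_right h (by positivity)
  have htsum : ∫⁻ ω, ∑' k, ENNReal.ofReal (F k ω) ∂μ ≠ ⊤ := by
    rw [lintegral_tsum fun k => (hFm k).ennreal_ofReal.aemeasurable]
    refine ne_top_of_le_ne_top ?_ (ENNReal.tsum_le_tsum hFint)
    exact (Real.summable_one_div_nat_pow.2 one_lt_two).tsum_ofReal_ne_top
  filter_upwards [ae_lt_top (Measurable.tsum fun k => (hFm k).ennreal_ofReal) htsum]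
    with ω hω
  have h0 := ENNReal.tendsto_atTop_zero_of_tsum_ne_top hω.ne
  have h1 : Tendsto (fun k => F k ω) atTop (𝓝 0) := by
    have := (ENNReal.tendsto_toReal ENNReal.zero_ne_top).comp h0
    refine this.congr fun k => ?_
    exact ENNReal.toReal_ofReal (sq_nonneg _)
  exact tendsto_zero_of_sq h1

lemma tendsto_nat_sqrt_atTop : Tendsto Nat.sqrt atTop atTop :=
  tendsto_atTop_atTop_of_monotone (fun _ _ h => Nat.sqrt_le_sqrt h) fun b =>
    ⟨b ^ 2, (Nat.sqrt_eq' b).ge⟩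

lemma ae_tendsto_centredCount_div [IsProbabilityMeasure μ] (hP : ∀ i j, 0 ≤ P i j)
    (hP1 : ∀ i j, P i j ≤ 1)
    (hμ : ∀ T : ℕ, ∀ s : ℕ → Fin d, μ {ω | ∀ t ≤ T, ω t = s t} =
      ENNReal.ofReal (if s 0 = ξ0 then ∏ t ∈ Finset.range T, P (s t) (s (t + 1)) else 0))
    (i j : Fin d) :
    ∀ᵐ ω ∂μ, Tendsto (fun T : ℕ => centredCount P i j T ω / T) atTop (𝓝 0) := by
  filter_upwards [ae_tendsto_centredCount_sq_div hP hP1 hμ i j] with ω hω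
  have h2 : Tendsto (fun k : ℕ => |centredCount P i j (k ^ 2) ω / (k : ℝ) ^ 2| + 2 / k)
      atTop (𝓝 0) := by
    simpa using hω.abs.add (tendsto_const_div_atTop_nhds_zero_nat (2 : ℝ))
  refine squeeze_zero_norm' ?_ (h2.comp tendsto_nat_sqrt_atTop)
  filter_upwards [eventually_ge_atTop 1] with T hT
  have hk : 0 < T.sqrt := Nat.sqrt_pos.2 hT
  have hle : T.sqrt ^ 2 ≤ T := Nat.sqrt_le' T
  obtain ⟨n, hn⟩ := Nat.exists_eq_add_of_le hle
  have hn2 : n ≤ 2 * T.sqrt := by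
    have := Nat.sqrt_le_add T
    nlinarith
  have hd := abs_centredCount_sub_le (hP i j) (hP1 i j) (T.sqrt ^ 2) n ω
  rw [← hn] at hd
  simp only [Function.comp]
  generalize T.sqrt = k at *
  have hk0 : (0 : ℝ) < k := by exact_mod_cast hk
  have hle' : (k : ℝ) ^ 2 ≤ T := by exact_mod_cast hle
  have hn2' : (n : ℝ) ≤ 2 * k := by exact_mod_cast hn2
  have hM : |centredCount P i j T ω| ≤ |centredCount P i j (k ^ 2) ω| + 2 * k := by
    have := abs_sub_abs_le_abs_sub (centredCount P i j T ω) (centredCount P i j (k ^ 2) ω)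
    linarith
  rw [Real.norm_eq_abs, abs_div, Nat.abs_cast, abs_div, abs_of_pos (by positivity : (0 : ℝ) < k ^ 2)]
  calc |centredCount P i j T ω| / T
      ≤ (|centredCount P i j (k ^ 2) ω| + 2 * k) / (k : ℝ) ^ 2 := by gcongr
    _ = |centredCount P i j (k ^ 2) ω| / (k : ℝ) ^ 2 + 2 / k := by
      rw [add_div]
      field_simp

lemma transOf_nonneg {θ : Matrix (Fin d) (Fin d) ℝ} (hθ : ∀ i j, 0 ≤ θ i j) (i j : Fin d) :
    0 ≤ transOf θ i j :=
  div_nonneg (hθ i j) (Finset.sum_nonneg fun k _ => hθ i k)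

lemma transOf_le_one {θ : Matrix (Fin d) (Fin d) ℝ} (hθ : ∀ i j, 0 ≤ θ i j) (i j : Fin d) :
    transOf θ i j ≤ 1 :=
  (Finset.single_le_sum (f := fun j => transOf θ i j) (fun k _ => transOf_nonneg hθ i k)
    (Finset.mem_univ j)).trans (rowSum_transOf_le_one θ i)

/-- Strong law of large numbers for the empirical doublet distribution. -/
lemma ae_tendsto_empDoublet [IsProbabilityMeasure μ] {θ : Matrix (Fin d) (Fin d) ℝ}
    (hθ : θ ∈ Theta d)
    (hμ : ∀ T : ℕ, ∀ s : ℕ → Fin d, μ {ω | ∀ t ≤ T, ω t = s t} =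
      ENNReal.ofReal
        (if s 0 = ξ0 then ∏ t ∈ Finset.range T, transOf θ (s t) (s (t + 1)) else 0)) :
    ∀ᵐ ω ∂μ, Tendsto (fun T => empDoublet T ω) atTop (𝓝 θ) := by
  have hnn : ∀ i j, 0 ≤ θ i j := fun i j => (hθ.1 i j).le
  have h : ∀ᵐ ω ∂μ, ∀ i j,
      Tendsto (fun T : ℕ => centredCount (transOf θ) i j T ω / T) atTop (𝓝 0) :=
    ae_all_iff.2 fun i => ae_all_iff.2 fun j =>
      ae_tendsto_centredCount_div (transOf_nonneg hnn) (transOf_le_one hnn) hμ i j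
  filter_upwards [h] with ω hω
  refine tendsto_of_approx_stationary hθ
    (Eventually.of_forall fun T => empDoublet_nonneg T ω)
    ((eventually_ge_atTop 1).mono fun T hT => sum_empDoublet hT ω) (fun i => ?_) fun i j => ?_
  · refine squeeze_zero_norm (fun T => ?_) tendsto_one_div_atTop_nhds_zero_nat
    rw [rowSum_sub_colSum_empDoublet, norm_mul, Real.norm_of_nonneg (by positivity)]
    refine mul_le_of_le_one_right (by positivity) ?_
    split_ifs <;> norm_num
  · exact (hω i j).congr fun T => (empDoublet_sub_eq _ i j T ω).symm

end LawOfLargeNumbers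

section Predictor

variable {d : ℕ}

/-- Conditional relative entropy balls with vanishing radii around convergent centres shrink to
the limit of the centres. -/
lemma tendsto_of_condRelEnt_le {θ : Matrix (Fin d) (Fin d) ℝ} (hθ : θ ∈ Theta d)
    {A B : ℕ → Matrix (Fin d) (Fin d) ℝ} (hA : Tendsto A atTop (𝓝 θ))
    {r : ℕ → ℝ} (hr : Tendsto r atTop (𝓝 0))
    (hB : ∀ᶠ T in atTop, B T ∈ closure (Theta d) ∧ condRelEnt (A T) (B T) ≤ (r T : EReal))
    (hApos : ∀ᶠ T in atTop, ∀ i j, 0 < A T i j) :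
    Tendsto B atTop (𝓝 θ) := by
  have hAe : ∀ i j, Tendsto (fun T => A T i j) atTop (𝓝 (θ i j)) := fun i j =>
    ((continuous_id.matrix_elem i j).tendsto θ).comp hA
  have hAw : ∀ i, Tendsto (fun T => ∑ k, A T i k) atTop (𝓝 (∑ k, θ i k)) := fun i =>
    tendsto_finsetSum _ fun k _ => hAe i k
  have hw := rowSum_pos_of_pos hθ.1
  have hAP : ∀ i j, Tendsto (fun T => transOf (A T) i j) atTop (𝓝 (transOf θ i j)) :=
    fun i j => (hAe i j).div (hAw i) (hw i).ne'
  have hBP : ∀ i j, Tendsto (fun T => transOf (B T) i j - transOf (A T) i j) atTop (𝓝 0) := by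
    intro i j
    refine tendsto_zero_of_sq ?_
    have hlim : Tendsto (fun T => 4 * (r T / ∑ k, A T i k)) atTop (𝓝 0) := by
      simpa using (hr.div (hAw i) (hw i).ne').const_mul 4
    refine squeeze_zero' (Eventually.of_forall fun T => sq_nonneg _) ?_ hlim
    filter_upwards [hB, hApos] with T hBT hAT
    have hBnn := (closure_Theta_subset hBT.1).1
    have hAnn : ∀ i j, 0 ≤ A T i j := fun i j => (hAT i j).le
    have h := sq_sqrt_transOf_sub_le hAT hBnn hBT.2 i j
    rw [mul_comm, ← le_div_iff₀ (rowSum_pos_of_pos hAT i)] at h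
    refine le_trans ?_ (mul_le_mul_of_nonneg_left h zero_le_four)
    have ha := Real.sq_sqrt (transOf_nonneg hAnn i j)
    have hb := Real.sq_sqrt (transOf_nonneg hBnn i j)
    have ha1 := Real.sqrt_le_one.2 (transOf_le_one hAnn i j)
    have hb1 := Real.sqrt_le_one.2 (transOf_le_one hBnn i j)
    have ha0 := Real.sqrt_nonneg (transOf (A T) i j)
    have hb0 := Real.sqrt_nonneg (transOf (B T) i j)
    have hfac : (transOf (B T) i j - transOf (A T) i j) ^ 2 =
        (√(transOf (A T) i j) + √(transOf (B T) i j)) ^ 2 *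
          (√(transOf (A T) i j) - √(transOf (B T) i j)) ^ 2 := by
      rw [← mul_pow, ← sq_sub_sq, ha, hb]
      ring
    rw [hfac]
    refine mul_le_mul_of_nonneg_right ?_ (sq_nonneg _)
    nlinarith
  refine tendsto_of_approx_stationary hθ (hB.mono fun T h => (closure_Theta_subset h.1).1)
    (hB.mono fun T h => (closure_Theta_subset h.1).2.1) (fun i => ?_) fun i j => ?_
  · exact tendsto_const_nhds.congr' (hB.mono fun T h =>
      (sub_eq_zero.2 ((closure_Theta_subset h.1).2.2 i)).symm)
  · have hlim : Tendsto (fun T => transOf (B T) i j - transOf θ i j) atTop (𝓝 0) := by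
      have := (hBP i j).add ((hAP i j).sub_const (transOf θ i j))
      simpa using this
    refine squeeze_zero_norm' ?_ (by simpa using hlim.norm)
    filter_upwards [hB] with T hBT
    obtain ⟨hnn, hsum, -⟩ := closure_Theta_subset hBT.1
    have hrow0 : 0 ≤ ∑ k, B T i k := Finset.sum_nonneg fun k _ => hnn i k
    have hBeq : B T i j = (∑ k, B T i k) * transOf (B T) i j := by
      rcases hrow0.eq_or_lt with h | h
      · rw [← h, zero_mul]
        exact (Finset.sum_eq_zero_iff_of_nonneg fun k _ => hnn i k).1 h.symm j (Finset.mem_univ j)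
      · exact (mul_div_cancel₀ _ h.ne').symm
    have hfac : B T i j - (∑ k, B T i k) * transOf θ i j =
        (∑ k, B T i k) * (transOf (B T) i j - transOf θ i j) := by
      rw [mul_sub, ← hBeq]
    rw [hfac, norm_mul, Real.norm_of_nonneg hrow0]
    exact mul_le_of_le_one_left (norm_nonneg _) (rowSum_le_one hnn hsum i)

lemma continuous_cfun (ℓ : Fin d → ℝ) : Continuous (cfun ℓ) := by
  unfold cfun
  fun_prop

lemma bddAbove_cfun_image_closure_Theta (ℓ : Fin d → ℝ) :
    BddAbove (cfun ℓ '' closure (Theta d)) := by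
  refine ⟨∑ i : Fin d, ∑ _j : Fin d, |ℓ i|, ?_⟩
  rintro _ ⟨θ, hθ, rfl⟩
  obtain ⟨h0, h1, -⟩ := closure_Theta_subset hθ
  refine Finset.sum_le_sum fun i _ => Finset.sum_le_sum fun j _ => ?_
  exact (mul_le_mul_of_nonneg_right (le_abs_self _) (h0 i j)).trans
    (mul_le_of_le_one_right (abs_nonneg _) (entry_le_one h0 h1 i j))

lemma tendsto_chat {θ : Matrix (Fin d) (Fin d) ℝ} (hθ : θ ∈ Theta d) (ℓ : Fin d → ℝ)
    {A : ℕ → Matrix (Fin d) (Fin d) ℝ} (hA : Tendsto A atTop (𝓝 θ))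
    {r : ℕ → ℝ} (hr : Tendsto r atTop (𝓝 0)) (hApos : ∀ᶠ T in atTop, ∀ i j, 0 < A T i j)
    (hne : ∀ᶠ T in atTop,
      {B | B ∈ closure (Theta d) ∧ condRelEnt (A T) B ≤ (r T : EReal)}.Nonempty) :
    Tendsto (fun T => chat ℓ (r T) (A T)) atTop (𝓝 (cfun ℓ θ)) := by
  have hex : ∀ T : ℕ, ∃ B : Matrix (Fin d) (Fin d) ℝ,
      {B | B ∈ closure (Theta d) ∧ condRelEnt (A T) B ≤ (r T : EReal)}.Nonempty →
      (B ∈ closure (Theta d) ∧ condRelEnt (A T) B ≤ (r T : EReal)) ∧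
        |chat ℓ (r T) (A T) - cfun ℓ B| ≤ 1 / ((T : ℝ) + 1) := by
    intro T
    by_cases h : {B | B ∈ closure (Theta d) ∧ condRelEnt (A T) B ≤ (r T : EReal)}.Nonempty
    · have hlt := sub_lt_self (chat ℓ (r T) (A T)) (Nat.one_div_pos_of_nat (α := ℝ) (n := T))
      have hchat : chat ℓ (r T) (A T) = sSup (cfun ℓ ''
          {B | B ∈ closure (Theta d) ∧ condRelEnt (A T) B ≤ (r T : EReal)}) := if_pos h
      nth_rewrite 2 [hchat] at hlt
      obtain ⟨_, ⟨B, hB, rfl⟩, hBlt⟩ := exists_lt_of_lt_csSup (h.image _) hlt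
      refine ⟨B, fun _ => ⟨hB, ?_⟩⟩
      have hle : cfun ℓ B ≤ chat ℓ (r T) (A T) := by
        rw [hchat]
        exact le_csSup ((bddAbove_cfun_image_closure_Theta ℓ).mono
          (Set.image_mono fun _ h => h.1)) ⟨B, hB, rfl⟩
      rw [abs_of_nonneg (by linarith)]
      linarith
    · exact ⟨0, fun h' => absurd h' h⟩
  choose B hB using hex
  have hBlim : Tendsto B atTop (𝓝 θ) :=
    tendsto_of_condRelEnt_le hθ hA hr (hne.mono fun T h => (hB T h).1) hApos
  have hdiff : Tendsto (fun T => chat ℓ (r T) (A T) - cfun ℓ (B T)) atTop (𝓝 0) :=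
    squeeze_zero_norm' (hne.mono fun T h => (hB T h).2) tendsto_one_div_add_atTop_nhds_zero_nat
  simpa using hdiff.add (((continuous_cfun ℓ).tendsto θ).comp hBlim)

end Predictor

theorem stmt_13 (d n : ℕ) (hd : 1 ≤ d) (X : Set (Fin n → ℝ)) (hX : IsCompact X)
    (L : (Fin n → ℝ) → Fin d → ℝ) (hL : ∀ i, ContinuousOn (fun x => L x i) X)
    (θ : Matrix (Fin d) (Fin d) ℝ) (hθ : θ ∈ Theta d) (ξ0 : Fin d)
    (μ : MeasureTheory.Measure (ℕ → Fin d)) [MeasureTheory.IsProbabilityMeasure μ]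
    (hμ : ∀ T : ℕ, ∀ s : ℕ → Fin d,
      μ {ω | ∀ t ≤ T, ω t = s t} =
        ENNReal.ofReal
          (if s 0 = ξ0 then ∏ t ∈ Finset.range T, transOf θ (s t) (s (t + 1)) else 0))
    (r : ℕ → ℝ) (hr1 : ∀ T : ℕ, 1 ≤ T → (d : ℝ) / (T : ℝ) ≤ r T)
    (hr2 : Filter.Tendsto r Filter.atTop (nhds 0))
    (x : Fin n → ℝ) (hx : x ∈ X) :
    ∀ᵐ ω ∂μ, Filter.Tendsto (fun T => chat (L x) (r T) (empDoublet T ω))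
      Filter.atTop (nhds (cfun (L x) θ)) := by
  filter_upwards [ae_tendsto_empDoublet hθ hμ] with ω hω
  have hpos : ∀ᶠ T in atTop, ∀ i j, 0 < empDoublet T ω i j :=
    eventually_all.2 fun i => eventually_all.2 fun j =>
      (((continuous_id.matrix_elem i j).tendsto θ).comp hω).eventually_const_lt (hθ.1 i j)
  refine tendsto_chat hθ (L x) hω hr2 hpos ?_
  filter_upwards [hpos, eventually_ge_atTop 1] with T hT hT1
  refine ⟨_, subset_closure (addTransition_empDoublet_mem_Theta hT1 ω hT),
    (condRelEnt_addTransition_le hT1 hT _ _).trans (EReal.coe_le_coe_iff.2 ?_)⟩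
  refine le_trans ?_ (hr1 T hT1)
  gcongr
  exact_mod_cast hd
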